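/- Suppose λ < 0. If u and v are Dirichlet weak solutions of (P_λ) with u(x) > 0 and v(x) > 0 for every x ∈ Ω, then u = v on Ω. In other words, (P_λ) has at most one positive solution for λ < 0. -/

import Mathlib

open MeasureTheory RealInnerProductSpace

noncomputable section

/-- A test function: smooth, compactly supported, with support contained in `Ω`. -/
def IsTestFun {N : ℕ} (Ω : Set (EuclideanSpace ℝ (Fin N)))
    (φ : EuclideanSpace ℝ (Fin N) → ℝ) : Prop :=
  ContDiff ℝ (⊤ : ℕ∞) φ ∧ HasCompactSupport φ ∧ tsupport φ ⊆ Ω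

/-- A Dirichlet weak solution of `(P_λ)` with exponent `q` and weight `a`:
continuous on the closure of `Ω`, continuously differentiable in `Ω`, nonnegative in `Ω`,
vanishing on the boundary, with `∫_Ω ‖∇u‖^p < ∞`, satisfying the weak form of
`-Δ_p u = λ u^{p-1} + a u^{q-1}`. -/
def DirichletSol {N : ℕ} (Ω : Set (EuclideanSpace ℝ (Fin N))) (p q lam : ℝ)
    (a u : EuclideanSpace ℝ (Fin N) → ℝ) : Prop :=
  ContinuousOn u (closure Ω) ∧
  (∀ x ∈ Ω, DifferentiableAt ℝ u x) ∧
  ContinuousOn (fun x => gradient u x) Ω ∧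
  (∀ x ∈ Ω, 0 ≤ u x) ∧
  (∀ x ∈ frontier Ω, u x = 0) ∧
  IntegrableOn (fun x => ‖gradient u x‖ ^ p) Ω ∧
  ∀ φ : EuclideanSpace ℝ (Fin N) → ℝ, IsTestFun Ω φ →
    (∫ x in Ω, ‖gradient u x‖ ^ (p - 2) * ⟪gradient u x, gradient φ x⟫)
      = ∫ x in Ω, (lam * u x ^ (p - 1) + a x * u x ^ (q - 1)) * φ x

/-- `λ₁`: the infimum of `∫_Ω ‖∇φ‖^p` over test functions normalized in `L^p`. -/
def lambda1 {N : ℕ} (Ω : Set (EuclideanSpace ℝ (Fin N))) (p : ℝ) : ℝ :=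
  sInf { E : ℝ | ∃ φ : EuclideanSpace ℝ (Fin N) → ℝ, IsTestFun Ω φ ∧
    (∫ x in Ω, |φ x| ^ p) = 1 ∧ E = ∫ x in Ω, ‖gradient φ x‖ ^ p }

/-- `λ*(a,r)`: the infimum of `∫_Ω ‖∇φ‖^p` over normalized test functions with
`∫_Ω a |φ|^r ≥ 0`. -/
def lambdaStar {N : ℕ} (Ω : Set (EuclideanSpace ℝ (Fin N))) (p r : ℝ)
    (a : EuclideanSpace ℝ (Fin N) → ℝ) : ℝ :=
  sInf { E : ℝ | ∃ φ : EuclideanSpace ℝ (Fin N) → ℝ, IsTestFun Ω φ ∧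
    (∫ x in Ω, |φ x| ^ p) = 1 ∧ (0 ≤ ∫ x in Ω, a x * |φ x| ^ r) ∧
    E = ∫ x in Ω, ‖gradient φ x‖ ^ p }

open Set Filter Topology

/-- A compactly supported `C¹` function is approximated, uniformly and together with its
derivative, by test functions. -/
theorem exists_isTestFun_fderiv_approx {N : ℕ} {Ω : Set (EuclideanSpace ℝ (Fin N))}
    (hΩ : IsOpen Ω) {φ : EuclideanSpace ℝ (Fin N) → ℝ} (hφ : ContDiff ℝ 1 φ)
    (hc : HasCompactSupport φ) (hs : tsupport φ ⊆ Ω) {ε : ℝ} (hε : 0 < ε) :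
    ∃ ψ, IsTestFun Ω ψ ∧ (∀ x, dist (ψ x) (φ x) ≤ ε) ∧
      ∀ x, dist (fderiv ℝ ψ x) (fderiv ℝ φ x) ≤ ε := by
  have hf : Continuous (fderiv ℝ φ) := hφ.continuous_fderiv one_ne_zero
  obtain ⟨δ₁, hδ₁, h₁⟩ := Metric.uniformContinuous_iff.1
    (hc.uniformContinuous_of_continuous hφ.continuous) ε hε
  obtain ⟨δ₂, hδ₂, h₂⟩ := Metric.uniformContinuous_iff.1
    ((hc.fderiv ℝ).uniformContinuous_of_continuous hf) ε hε
  obtain ⟨δ₃, hδ₃, h₃⟩ := hc.isCompact.exists_cthickening_subset_open hΩ hs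
  have hδ : 0 < min δ₁ (min δ₂ δ₃) := by positivity
  set δ := min δ₁ (min δ₂ δ₃) with hδdef
  let b : ContDiffBump (0 : EuclideanSpace ℝ (Fin N)) := ⟨δ / 2, δ, by positivity, by linarith⟩
  have hb : LocallyIntegrable (b.normed volume) :=
    (b.continuous_normed (μ := volume)).locallyIntegrable
  have hd : ∀ x, fderiv ℝ (convolution (b.normed volume) φ (ContinuousLinearMap.lsmul ℝ ℝ)
      volume) x =
      convolution (b.normed volume) (fderiv ℝ φ) (ContinuousLinearMap.lsmul ℝ ℝ) volume x := by
    intro x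
    exact (hc.hasFDerivAt_convolution_right (ContinuousLinearMap.lsmul ℝ ℝ) hb hφ x).fderiv
  refine ⟨convolution (b.normed volume) φ (ContinuousLinearMap.lsmul ℝ ℝ) volume,
    ⟨?_, ?_, ?_⟩, ?_, ?_⟩
  · exact b.hasCompactSupport_normed.contDiff_convolution_left _ b.contDiff_normed
      hφ.continuous.locallyIntegrable
  · exact b.hasCompactSupport_normed.convolution _ hc
  · refine subset_trans ?_ h₃
    refine closure_minimal ?_ Metric.isClosed_cthickening
    refine (support_convolution_subset _).trans ?_
    rw [b.support_normed_eq]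
    rintro _ ⟨y, hy, z, hz, rfl⟩
    refine Metric.mem_cthickening_of_dist_le _ z _ _ (subset_tsupport _ hz) ?_
    have : ‖y‖ < δ := by simpa using hy
    have h4 : δ ≤ δ₃ := (min_le_right _ _).trans (min_le_right _ _)
    simpa using this.le.trans h4
  · intro x
    refine b.dist_normed_convolution_le hφ.continuous.aestronglyMeasurable fun y hy => ?_
    exact (h₁ (lt_of_lt_of_le hy (min_le_left _ _))).le
  · intro x
    rw [hd]
    refine b.dist_normed_convolution_le hf.aestronglyMeasurable fun y hy => ?_
    exact (h₂ (lt_of_lt_of_le hy ((min_le_right _ _).trans (min_le_left _ _)))).le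

/-- A weak formulation that holds for test functions holds for compactly supported `C¹`
functions. -/
theorem integral_fderiv_eq_of_contDiff_one {N : ℕ} {Ω : Set (EuclideanSpace ℝ (Fin N))}
    (hΩ : IsOpen Ω) {G : EuclideanSpace ℝ (Fin N) → EuclideanSpace ℝ (Fin N)}
    {f : EuclideanSpace ℝ (Fin N) → ℝ} (hG : IntegrableOn G Ω) (hf : IntegrableOn f Ω)
    (hweak : ∀ φ, IsTestFun Ω φ → ∫ x in Ω, fderiv ℝ φ x (G x) = ∫ x in Ω, f x * φ x)
    {φ : EuclideanSpace ℝ (Fin N) → ℝ} (hφ : ContDiff ℝ 1 φ)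
    (hc : HasCompactSupport φ) (hs : tsupport φ ⊆ Ω) :
    ∫ x in Ω, fderiv ℝ φ x (G x) = ∫ x in Ω, f x * φ x := by
  have key : ∀ ψ : EuclideanSpace ℝ (Fin N) → ℝ, ContDiff ℝ 1 ψ → HasCompactSupport ψ →
      IntegrableOn (fun x => fderiv ℝ ψ x (G x)) Ω ∧ IntegrableOn (fun x => f x * ψ x) Ω := by
    intro ψ hψ hψc
    have hψ' : Continuous (fderiv ℝ ψ) := hψ.continuous_fderiv one_ne_zero
    obtain ⟨C, hC⟩ := hψc.exists_bound_of_continuous hψ.continuous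
    obtain ⟨D, hD⟩ := (hψc.fderiv ℝ).exists_bound_of_continuous hψ'
    constructor
    · refine Integrable.mono' (hG.norm.const_mul D) ?_ (ae_of_all _ fun x => ?_)
      · exact (isBoundedBilinearMap_apply.continuous).comp_aestronglyMeasurable
          (hψ'.aestronglyMeasurable.prodMk hG.aestronglyMeasurable)
      · exact ((fderiv ℝ ψ x).le_opNorm _).trans
          (mul_le_mul_of_nonneg_right (hD x) (norm_nonneg _))
    · exact hf.mul_bdd (c := C) hψ.continuous.aestronglyMeasurable (ae_of_all _ hC)
  set K := (∫ x in Ω, ‖G x‖) + ∫ x in Ω, ‖f x‖ with hK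
  have hK0 : 0 ≤ K := by positivity
  have hle : ∀ ε > 0, dist (∫ x in Ω, fderiv ℝ φ x (G x)) (∫ x in Ω, f x * φ x) ≤ ε * K := by
    intro ε hε
    obtain ⟨ψ, hψ, h1, h2⟩ := exists_isTestFun_fderiv_approx hΩ hφ hc hs hε
    obtain ⟨i1, i2⟩ := key φ hφ hc
    obtain ⟨j1, j2⟩ := key ψ (hψ.1.of_le (by exact_mod_cast le_top)) hψ.2.1
    have e1 : dist (∫ x in Ω, fderiv ℝ φ x (G x)) (∫ x in Ω, fderiv ℝ ψ x (G x))
        ≤ ε * ∫ x in Ω, ‖G x‖ := by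
      rw [dist_eq_norm, ← integral_sub i1 j1, ← integral_const_mul]
      refine norm_integral_le_of_norm_le (hG.norm.const_mul ε) (ae_of_all _ fun x => ?_)
      rw [← sub_apply]
      refine (ContinuousLinearMap.le_opNorm _ _).trans ?_
      gcongr
      rw [← dist_eq_norm, dist_comm]
      exact h2 x
    have e2 : dist (∫ x in Ω, f x * ψ x) (∫ x in Ω, f x * φ x) ≤ ε * ∫ x in Ω, ‖f x‖ := by
      rw [dist_eq_norm, ← integral_sub j2 i2, ← integral_const_mul]
      refine norm_integral_le_of_norm_le (hf.norm.const_mul ε) (ae_of_all _ fun x => ?_)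
      rw [← mul_sub, norm_mul, mul_comm, ← dist_eq_norm]
      gcongr
      exact h1 x
    rw [← hweak ψ hψ] at e2
    calc _ ≤ _ := dist_triangle _ _ _
      _ ≤ _ := add_le_add e1 e2
      _ = ε * K := by rw [hK]; ring
  refine dist_le_zero.1 (le_of_forall_pos_le_add fun η hη => ?_)
  refine (hle (η / (K + 1)) (by positivity)).trans ?_
  rw [zero_add, div_mul_eq_mul_div, div_le_iff₀ (by positivity)]
  nlinarith

/-- A `C¹` truncation of the identity which vanishes on `[-1, 1]`. -/
theorem exists_contDiff_truncation :
    ∃ T : ℝ → ℝ, ContDiff ℝ 1 T ∧ (∀ s, |s| ≤ 1 → T s = 0) ∧ (∀ s, 2 ≤ |s| → T s = s) ∧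
      (∀ s, |T s| ≤ |s|) ∧ (deriv T 0 = 0) ∧ (∀ s, 2 < |s| → deriv T s = 1) ∧
      ∃ C, ∀ s, |deriv T s| ≤ C := by
  let b : ContDiffBump (0 : ℝ) := ⟨1, 2, by norm_num, by norm_num⟩
  let T : ℝ → ℝ := fun s => s - s * b s
  have hT : ContDiff ℝ 1 T := contDiff_id.sub (contDiff_id.mul b.contDiff)
  have h1 : ∀ s, |s| ≤ 1 → T s = 0 := fun s hs => by
    have : b s = 1 := b.one_of_mem_closedBall (by simpa using hs)
    simp [T, this]
  have h2 : ∀ s, 2 ≤ |s| → T s = s := fun s hs => by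
    have : b s = 0 := b.zero_of_le_dist (by simpa using hs)
    simp [T, this]
  have h3 : deriv T 0 = 0 := by
    have : T =ᶠ[𝓝 0] fun _ => 0 := by
      filter_upwards [Metric.closedBall_mem_nhds (0 : ℝ) one_pos] with s hs
      exact h1 s (by simpa using hs)
    rw [this.deriv_eq, deriv_const]
  have h4 : ∀ s, 2 < |s| → deriv T s = 1 := fun s hs => by
    have : T =ᶠ[𝓝 s] id := by
      filter_upwards [continuous_abs.continuousAt.eventually (lt_mem_nhds hs)] with t ht
      exact h2 t ht.le
    rw [this.deriv_eq, deriv_id]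
  refine ⟨T, hT, h1, h2, fun s => ?_, h3, h4, ?_⟩
  · have : T s = s * (1 - b s) := by simp only [T]; ring
    rw [this, abs_mul, abs_of_nonneg (sub_nonneg.2 b.le_one)]
    exact mul_le_of_le_one_right (abs_nonneg _) (by linarith [b.nonneg (x := s)])
  · obtain ⟨C, hC⟩ := (isCompact_closedBall (0 : ℝ) 2).exists_bound_of_continuousOn
      (hT.continuous_deriv le_rfl).continuousOn
    refine ⟨max C 1, fun s => ?_⟩
    rcases le_or_gt |s| 2 with hs | hs
    · exact (hC s (by simpa using hs)).trans (le_max_left _ _)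
    · rw [h4 s hs, abs_one]; exact le_max_right _ _

/-- A weak formulation extends to functions which are `C¹` in `Ω`, continuous on the closure
and zero on the boundary, except that the gradient term has to be restricted to the set where
the function does not vanish. -/
theorem integral_fderiv_eq_of_frontier_eq_zero {N : ℕ} {Ω : Set (EuclideanSpace ℝ (Fin N))}
    (hΩ : IsOpen Ω) (hΩb : Bornology.IsBounded Ω)
    {G : EuclideanSpace ℝ (Fin N) → EuclideanSpace ℝ (Fin N)}
    {f : EuclideanSpace ℝ (Fin N) → ℝ} (hG : IntegrableOn G Ω) (hf : IntegrableOn f Ω)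
    (hweak : ∀ φ, IsTestFun Ω φ → ∫ x in Ω, fderiv ℝ φ x (G x) = ∫ x in Ω, f x * φ x)
    {φ : EuclideanSpace ℝ (Fin N) → ℝ} (hφ : ContDiffOn ℝ 1 φ Ω)
    (hφc : ContinuousOn φ (closure Ω)) (h0 : ∀ x ∈ frontier Ω, φ x = 0)
    (hint : IntegrableOn (fun x => fderiv ℝ φ x (G x)) Ω) :
    ∫ x in Ω, {x | φ x ≠ 0}.indicator (fun x => fderiv ℝ φ x (G x)) x
      = ∫ x in Ω, f x * φ x := by
  obtain ⟨T, hT, hT1, hT2, hTle, hT'0, hT'1, C, hC⟩ := exists_contDiff_truncation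
  have hcpt : IsCompact (closure Ω) := hΩb.isCompact_closure
  obtain ⟨M, hM⟩ := hcpt.exists_bound_of_continuousOn hφc
  let c : ℕ → ℝ := fun n => n + 1
  have hc0 : ∀ n, 0 < c n := fun n => by positivity
  let ψ : ℕ → EuclideanSpace ℝ (Fin N) → ℝ := fun n => Ω.indicator fun x => T (c n * φ x) / c n
  have hψΩ : ∀ n, ∀ x ∈ Ω, ψ n =ᶠ[𝓝 x] fun x => T (c n * φ x) / c n := fun n x hx => by
    filter_upwards [hΩ.mem_nhds hx] with y hy
    exact indicator_of_mem hy _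
  let K : ℕ → Set (EuclideanSpace ℝ (Fin N)) := fun n => closure Ω ∩ φ ⁻¹' {s | 1 ≤ |c n * s|}
  have hKc : ∀ n, IsCompact (K n) := fun n => by
    refine hcpt.of_isClosed_subset (hφc.preimage_isClosed_of_isClosed isClosed_closure ?_)
      inter_subset_left
    exact isClosed_le continuous_const (by fun_prop)
  have hKΩ : ∀ n, K n ⊆ Ω := fun n x hx => by
    by_contra hxΩ
    have : φ x = 0 := h0 x ⟨hx.1, by rwa [hΩ.interior_eq]⟩
    have h2 := hx.2
    simp [this] at h2
    linarith
  have hψK : ∀ n x, x ∉ K n → ψ n x = 0 := fun n x hx => by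
    by_cases hxΩ : x ∈ Ω
    · have : |c n * φ x| < 1 := not_le.1 fun h => hx ⟨subset_closure hxΩ, h⟩
      simp [ψ, hT1 _ this.le]
    · simp [ψ, hxΩ]
  have hts : ∀ n, tsupport (ψ n) ⊆ K n := fun n => by
    refine closure_minimal (fun x hx => ?_) (hKc n).isClosed
    by_contra h
    exact hx (hψK n x h)
  have hψd : ∀ n, ContDiff ℝ 1 (ψ n) := fun n => by
    refine contDiff_iff_contDiffAt.2 fun x => ?_
    by_cases hx : x ∈ Ω
    · refine ContDiffAt.congr_of_eventuallyEq ?_ (hψΩ n x hx)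
      have := hφ.contDiffAt (hΩ.mem_nhds hx)
      exact (hT.contDiffAt.comp x (contDiffAt_const.mul this)).div_const _
    · refine ContDiffAt.congr_of_eventuallyEq (contDiffAt_const (c := (0 : ℝ))) ?_
      filter_upwards [(hKc n).isClosed.isOpen_compl.mem_nhds fun h => hx (hKΩ n h)] with y hy
      exact hψK n y hy
  have hψ' : ∀ n, ∀ x ∈ Ω, fderiv ℝ (ψ n) x (G x)
      = deriv T (c n * φ x) * fderiv ℝ φ x (G x) := fun n x hx => by
    have h1 : HasFDerivAt φ (fderiv ℝ φ x) x :=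
      ((hφ.contDiffAt (hΩ.mem_nhds hx)).differentiableAt one_ne_zero).hasFDerivAt
    have h2 : HasDerivAt T (deriv T (c n * φ x)) (c n * φ x) :=
      (hT.differentiable one_ne_zero _).hasDerivAt
    have h3 := (h2.comp_hasFDerivAt x (h1.const_mul (c n))).mul_const (c n)⁻¹
    have h4 : HasFDerivAt (ψ n) _ x := h3.congr_of_eventuallyEq (hψΩ n x hx)
    rw [h4.fderiv]
    have := (hc0 n).ne'
    simp
    field_simp
  have hweakn : ∀ n, ∫ x in Ω, fderiv ℝ (ψ n) x (G x) = ∫ x in Ω, f x * ψ n x := fun n =>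
    integral_fderiv_eq_of_contDiff_one hΩ hG hf hweak (hψd n)
      ((hKc n).of_isClosed_subset (isClosed_tsupport _) (hts n)) ((hts n).trans (hKΩ n))
  have hlarge : ∀ s : ℝ, s ≠ 0 → ∀ᶠ n in atTop, 2 < |c n * s| := fun s hs => by
    have : Tendsto (fun n => |c n * s|) atTop atTop := by
      simp_rw [abs_mul]
      refine Tendsto.atTop_mul_const (abs_pos.2 hs) ?_
      refine tendsto_abs_atTop_atTop.comp ?_
      exact tendsto_atTop_add_const_right _ _ tendsto_natCast_atTop_atTop
    exact this.eventually_gt_atTop 2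
  have lim1 : Tendsto (fun n => ∫ x in Ω, fderiv ℝ (ψ n) x (G x)) atTop
      (𝓝 (∫ x in Ω, {x | φ x ≠ 0}.indicator (fun x => fderiv ℝ φ x (G x)) x)) := by
    refine tendsto_integral_of_dominated_convergence (fun x => C * ‖fderiv ℝ φ x (G x)‖)
      (fun n => ?_) (hint.norm.const_mul C) (fun n => ?_) ?_
    · exact (isBoundedBilinearMap_apply.continuous).comp_aestronglyMeasurable
        (((hψd n).continuous_fderiv one_ne_zero).aestronglyMeasurable.prodMk
          hG.aestronglyMeasurable)
    · filter_upwards [ae_restrict_mem hΩ.measurableSet] with x hx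
      rw [hψ' n x hx, norm_mul]
      gcongr
      exact hC _
    · filter_upwards [ae_restrict_mem hΩ.measurableSet] with x hx
      refine Tendsto.congr' ?_ tendsto_const_nhds
      by_cases h : φ x = 0
      · refine Eventually.of_forall fun n => ?_
        simp [hψ' n x hx, h, hT'0]
      · filter_upwards [hlarge _ h] with n hn
        simp [hψ' n x hx, hT'1 _ hn, h]
  have lim2 : Tendsto (fun n => ∫ x in Ω, f x * ψ n x) atTop (𝓝 (∫ x in Ω, f x * φ x)) := by
    refine tendsto_integral_of_dominated_convergence (fun x => ‖f x‖ * M)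
      (fun n => ?_) (hf.norm.mul_const M) (fun n => ?_) ?_
    · exact hf.aestronglyMeasurable.mul (hψd n).continuous.aestronglyMeasurable
    · filter_upwards [ae_restrict_mem hΩ.measurableSet] with x hx
      rw [norm_mul]
      gcongr
      refine le_trans ?_ (hM x (subset_closure hx))
      simp only [ψ, indicator_of_mem hx, norm_div, Real.norm_eq_abs]
      rw [div_le_iff₀ (abs_pos.2 (hc0 n).ne'), mul_comm, ← abs_mul]
      exact hTle _
    · filter_upwards [ae_restrict_mem hΩ.measurableSet] with x hx
      refine Tendsto.const_mul _ (Tendsto.congr' ?_ tendsto_const_nhds)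
      by_cases h : φ x = 0
      · refine Eventually.of_forall fun n => ?_
        simp [ψ, hx, h, hT1]
      · filter_upwards [hlarge _ h] with n hn
        simp only [ψ, indicator_of_mem hx, hT2 _ hn.le]
        field_simp [(hc0 n).ne']
  simp_rw [hweakn] at lim1
  exact tendsto_nhds_unique lim1 lim2

/-- Young's inequality in the form `x ^ (s - t) * y ^ t ≤ (1 - t / s) * x ^ s + t / s * y ^ s`. -/
theorem rpow_sub_mul_rpow_le {x y s t : ℝ} (hx : 0 ≤ x) (hy : 0 ≤ y) (ht : 0 ≤ t) (hts : t ≤ s)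
    (hs : 0 < s) : x ^ (s - t) * y ^ t ≤ (1 - t / s) * x ^ s + t / s * y ^ s := by
  have h := Real.geom_mean_le_arith_mean2_weighted (w₁ := 1 - t / s) (w₂ := t / s)
    (sub_nonneg.2 ((div_le_one hs).2 hts)) (by positivity)
    (Real.rpow_nonneg hx s) (Real.rpow_nonneg hy s) (by ring)
  rw [← Real.rpow_mul hx, ← Real.rpow_mul hy] at h
  convert h using 3 <;> field_simp

/-- The scalar inequality behind the generalized Picone inequality. -/
theorem picone_scalar {p q r A B : ℝ} (hq : 1 < q) (hqp : q < p) (hr : 0 < r)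
    (hA : 0 ≤ A) (hB : 0 ≤ B) :
    q * (r ^ (q - 1) * (A ^ (p - 1) * B)) - (q - 1) * (r ^ q * A ^ p)
      ≤ (1 - q / p) * A ^ p + q / p * B ^ p := by
  have hq0 : 0 < q := by linarith
  have hp0 : 0 < p := by linarith
  rcases hA.eq_or_lt with rfl | hA
  · rw [Real.zero_rpow (by linarith), Real.zero_rpow (by linarith)]
    simp only [zero_mul, mul_zero, sub_zero, zero_add]
    positivity
  have h1 := rpow_sub_mul_rpow_le (mul_pos hr hA).le hB zero_le_one hq.le hq0
  have h2 := rpow_sub_mul_rpow_le hA.le hB hq0.le hqp.le hp0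
  rw [Real.mul_rpow hr.le hA.le, Real.mul_rpow hr.le hA.le, Real.rpow_one] at h1
  have e1 : A ^ (p - 1) = A ^ (q - 1) * A ^ (p - q) := by
    rw [← Real.rpow_add hA]; congr 1; ring
  have e2 : A ^ p = A ^ q * A ^ (p - q) := by
    rw [← Real.rpow_add hA]; congr 1; ring
  have h3 := mul_le_mul_of_nonneg_left h1 (mul_pos hq0 (Real.rpow_pos_of_pos hA (p - q))).le
  have h4 : q * A ^ (p - q) * ((1 - 1 / q) * (r ^ q * A ^ q) + 1 / q * B ^ q)
      = (q - 1) * (r ^ q * A ^ p) + A ^ (p - q) * B ^ q := by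
    rw [e2]; field_simp
  rw [h4] at h3
  have h5 : q * (r ^ (q - 1) * (A ^ (p - 1) * B))
      = q * A ^ (p - q) * (r ^ (q - 1) * A ^ (q - 1) * B) := by rw [e1]; ring
  linarith

/-- The vector field `‖∇u‖ ^ (p - 2) ∇u`. -/
def pFlux {N : ℕ} (p : ℝ) (u : EuclideanSpace ℝ (Fin N) → ℝ) (x : EuclideanSpace ℝ (Fin N)) :
    EuclideanSpace ℝ (Fin N) :=
  ‖gradient u x‖ ^ (p - 2) • gradient u x

/-- The right-hand side of `(P_λ)`. -/
def source {N : ℕ} (p q lam : ℝ) (a u : EuclideanSpace ℝ (Fin N) → ℝ)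
    (x : EuclideanSpace ℝ (Fin N)) : ℝ :=
  lam * u x ^ (p - 1) + a x * u x ^ (q - 1)

/-- The function `((v + ε) ^ q - (u + ε) ^ q) / (u + ε) ^ (q - 1)`. -/
def piconeTest {N : ℕ} (q ε : ℝ) (u v : EuclideanSpace ℝ (Fin N) → ℝ)
    (x : EuclideanSpace ℝ (Fin N)) : ℝ :=
  (v x + ε) ^ q * (u x + ε) ^ (1 - q) - (u x + ε)

theorem norm_pFlux {N : ℕ} {p : ℝ} (hp : 1 < p) (u : EuclideanSpace ℝ (Fin N) → ℝ)
    (x : EuclideanSpace ℝ (Fin N)) : ‖pFlux p u x‖ = ‖gradient u x‖ ^ (p - 1) := by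
  rw [pFlux, norm_smul, Real.norm_of_nonneg (by positivity)]
  rcases (norm_nonneg (gradient u x)).eq_or_lt with h | h
  · rw [← h, mul_zero, Real.zero_rpow (by linarith)]
  · rw [← Real.rpow_add_one h.ne']; congr 1; ring

theorem fderiv_apply_pFlux {N : ℕ} (p : ℝ) (u v : EuclideanSpace ℝ (Fin N) → ℝ)
    (x : EuclideanSpace ℝ (Fin N)) :
    fderiv ℝ v x (pFlux p u x) = ‖gradient u x‖ ^ (p - 2) * ⟪gradient u x, gradient v x⟫ := by
  rw [pFlux, map_smul, smul_eq_mul, real_inner_comm, gradient, gradient,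
    InnerProductSpace.toDual_symm_apply]

theorem fderiv_apply_pFlux_self {N : ℕ} {p : ℝ} (hp : 1 < p)
    (u : EuclideanSpace ℝ (Fin N) → ℝ) (x : EuclideanSpace ℝ (Fin N)) :
    fderiv ℝ u x (pFlux p u x) = ‖gradient u x‖ ^ p := by
  rw [fderiv_apply_pFlux, real_inner_self_eq_norm_sq]
  rcases (norm_nonneg (gradient u x)).eq_or_lt with h | h
  · rw [← h, Real.zero_rpow (by linarith : p ≠ 0)]; simp
  · rw [← Real.rpow_natCast, ← Real.rpow_add h]; congr 1; norm_num

theorem abs_fderiv_apply_pFlux_le {N : ℕ} {p : ℝ} (hp : 1 < p)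
    (u v : EuclideanSpace ℝ (Fin N) → ℝ) (x : EuclideanSpace ℝ (Fin N)) :
    |fderiv ℝ v x (pFlux p u x)| ≤ ‖gradient u x‖ ^ (p - 1) * ‖gradient v x‖ := by
  rw [← norm_pFlux hp, ← InnerProductSpace.toDual_symm_apply, mul_comm]
  exact abs_real_inner_le_norm _ _

theorem DirichletSol.contDiffOn {N : ℕ} {Ω : Set (EuclideanSpace ℝ (Fin N))} (hΩ : IsOpen Ω)
    {p q lam : ℝ} {a u : EuclideanSpace ℝ (Fin N) → ℝ} (hu : DirichletSol Ω p q lam a u) :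
    ContDiffOn ℝ 1 u Ω := by
  rw [← zero_add 1, contDiffOn_succ_iff_fderiv_of_isOpen hΩ]
  refine ⟨fun x hx => (hu.2.1 x hx).differentiableWithinAt, by simp, ?_⟩
  rw [contDiffOn_zero]
  have h := (InnerProductSpace.toDual ℝ (EuclideanSpace ℝ (Fin N))).continuous.comp_continuousOn
    hu.2.2.1
  refine h.congr fun x _ => ?_
  simp [gradient]

theorem DirichletSol.nonneg_closure {N : ℕ} {Ω : Set (EuclideanSpace ℝ (Fin N))}
    {p q lam : ℝ} {a u : EuclideanSpace ℝ (Fin N) → ℝ} (hu : DirichletSol Ω p q lam a u)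
    {x : EuclideanSpace ℝ (Fin N)} (hx : x ∈ closure Ω) : 0 ≤ u x := by
  rw [closure_eq_self_union_frontier] at hx
  rcases hx with hx | hx
  · exact hu.2.2.2.1 x hx
  · exact (hu.2.2.2.2.1 x hx).ge

theorem DirichletSol.integrableOn_pFlux {N : ℕ} {Ω : Set (EuclideanSpace ℝ (Fin N))}
    (hΩ : IsOpen Ω) (hΩb : Bornology.IsBounded Ω) {p q lam : ℝ} (hp : 1 < p)
    {a u : EuclideanSpace ℝ (Fin N) → ℝ} (hu : DirichletSol Ω p q lam a u) :
    IntegrableOn (pFlux p u) Ω := by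
  have hm : AEStronglyMeasurable (fun x => gradient u x) (volume.restrict Ω) :=
    hu.2.2.1.aestronglyMeasurable hΩ.measurableSet
  have hc : IntegrableOn (fun _ : EuclideanSpace ℝ (Fin N) => (1 : ℝ)) Ω :=
    integrableOn_const hΩb.measure_lt_top.ne
  refine Integrable.mono' (hc.add hu.2.2.2.2.2.1) ?_ (ae_of_all _ fun x => ?_)
  · exact (hm.norm.aemeasurable.pow_const _).aestronglyMeasurable.smul hm
  · rw [norm_pFlux hp]
    have h := rpow_sub_mul_rpow_le (norm_nonneg (gradient u x)) zero_le_one zero_le_one hp.le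
      (by linarith)
    have h1 : 0 ≤ ‖gradient u x‖ ^ p := by positivity
    have h2 : 0 ≤ 1 / p ∧ 1 / p ≤ 1 := ⟨by positivity, (div_le_one (by linarith)).2 hp.le⟩
    simp only [Real.one_rpow, mul_one] at h
    simp only [Pi.add_apply]
    nlinarith

theorem DirichletSol.integrableOn_source {N : ℕ} {Ω : Set (EuclideanSpace ℝ (Fin N))}
    (hΩb : Bornology.IsBounded Ω) {p q lam : ℝ} (hp : 1 < p) (hq : 1 < q)
    {a u : EuclideanSpace ℝ (Fin N) → ℝ} (ha : ContinuousOn a (closure Ω))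
    (hu : DirichletSol Ω p q lam a u) : IntegrableOn (source p q lam a u) Ω := by
  have h : ContinuousOn (source p q lam a u) (closure Ω) :=
    (continuousOn_const.mul (hu.1.rpow_const fun _ _ => Or.inr (by linarith))).add
      (ha.mul (hu.1.rpow_const fun _ _ => Or.inr (by linarith)))
  exact (h.integrableOn_compact hΩb.isCompact_closure).mono_set subset_closure

theorem DirichletSol.integral_fderiv_eq {N : ℕ} {Ω : Set (EuclideanSpace ℝ (Fin N))}
    {p q lam : ℝ} {a u : EuclideanSpace ℝ (Fin N) → ℝ} (hu : DirichletSol Ω p q lam a u)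
    (φ : EuclideanSpace ℝ (Fin N) → ℝ) (hφ : IsTestFun Ω φ) :
    ∫ x in Ω, fderiv ℝ φ x (pFlux p u x) = ∫ x in Ω, source p q lam a u x * φ x := by
  simp_rw [fderiv_apply_pFlux]
  exact hu.2.2.2.2.2.2 φ hφ

theorem piconeTest_eq {N : ℕ} {q ε : ℝ} {u v : EuclideanSpace ℝ (Fin N) → ℝ}
    {x : EuclideanSpace ℝ (Fin N)} (h : 0 < u x + ε) :
    piconeTest q ε u v x = (u x + ε) ^ (1 - q) * ((v x + ε) ^ q - (u x + ε) ^ q) := by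
  have : (u x + ε) ^ (1 - q) * (u x + ε) ^ q = u x + ε := by
    rw [← Real.rpow_add h]; simp
  rw [piconeTest, mul_sub, this, mul_comm]

theorem piconeTest_eq_zero_iff {N : ℕ} {q ε : ℝ} (hq : 1 < q)
    {u v : EuclideanSpace ℝ (Fin N) → ℝ} {x : EuclideanSpace ℝ (Fin N)}
    (hu : 0 < u x + ε) (hv : 0 < v x + ε) : piconeTest q ε u v x = 0 ↔ u x = v x := by
  rw [piconeTest_eq hu, mul_eq_zero, or_iff_right (Real.rpow_pos_of_pos hu _).ne', sub_eq_zero,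
    Real.rpow_left_inj hv.le hu.le (by linarith), add_left_inj, eq_comm]

theorem fderiv_piconeTest_apply_pFlux {N : ℕ} {p q ε : ℝ} (hp : 1 < p)
    {u v : EuclideanSpace ℝ (Fin N) → ℝ} {x : EuclideanSpace ℝ (Fin N)}
    (hu : 0 < u x + ε) (hv : 0 < v x + ε) (hud : DifferentiableAt ℝ u x)
    (hvd : DifferentiableAt ℝ v x) :
    fderiv ℝ (piconeTest q ε u v) x (pFlux p u x) =
      q * (((v x + ε) / (u x + ε)) ^ (q - 1) * fderiv ℝ v x (pFlux p u x))
        - (q - 1) * (((v x + ε) / (u x + ε)) ^ q * ‖gradient u x‖ ^ p)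
        - ‖gradient u x‖ ^ p := by
  have hU := hud.hasFDerivAt.add_const ε
  have hV := hvd.hasFDerivAt.add_const ε
  have h : HasFDerivAt (piconeTest q ε u v) _ x :=
    ((hV.rpow_const (p := q) (Or.inl hv.ne')).mul
      (hU.rpow_const (p := 1 - q) (Or.inl hu.ne'))).sub hU
  rw [h.fderiv]
  have e1 : (u x + ε) ^ (1 - q) = ((u x + ε) ^ (q - 1))⁻¹ := by
    rw [← Real.rpow_neg hu.le]; congr 1; ring
  have e2 : (u x + ε) ^ (1 - q - 1) = ((u x + ε) ^ q)⁻¹ := by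
    rw [← Real.rpow_neg hu.le]; congr 1; ring
  simp only [sub_apply, add_apply, smul_apply,
    smul_eq_mul, fderiv_apply_pFlux_self hp, e1, e2, Real.div_rpow hv.le hu.le]
  ring

/-- The Picone-type inequality obtained by testing the equation of `u` with
`((v + ε) ^ q - (u + ε) ^ q) / (u + ε) ^ (q - 1)`. -/
theorem integral_source_mul_piconeTest_le {N : ℕ} {Ω : Set (EuclideanSpace ℝ (Fin N))}
    (hΩ : IsOpen Ω) (hΩb : Bornology.IsBounded Ω) {p q lam : ℝ} (hq : 1 < q) (hqp : q < p)
    {a u v : EuclideanSpace ℝ (Fin N) → ℝ} (ha : ContinuousOn a (closure Ω))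
    (hu : DirichletSol Ω p q lam a u) (hv : DirichletSol Ω p q lam a v) {ε : ℝ} (hε : 0 < ε) :
    ∫ x in Ω, source p q lam a u x * piconeTest q ε u v x ≤
      ∫ x in Ω, {x | u x ≠ v x}.indicator
        (fun x => q / p * (‖gradient v x‖ ^ p - ‖gradient u x‖ ^ p)) x := by
  have hp : 1 < p := hq.trans hqp
  have hu0 : ∀ x ∈ closure Ω, 0 < u x + ε := fun x hx => by linarith [hu.nonneg_closure hx]
  have hv0 : ∀ x ∈ closure Ω, 0 < v x + ε := fun x hx => by linarith [hv.nonneg_closure hx]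
  have hud := hu.contDiffOn hΩ
  have hvd := hv.contDiffOn hΩ
  have hC1 : ContDiffOn ℝ 1 (piconeTest q ε u v) Ω :=
    (((hvd.add contDiffOn_const).rpow_const_of_ne fun x hx => (hv0 x (subset_closure hx)).ne').mul
      ((hud.add contDiffOn_const).rpow_const_of_ne
        fun x hx => (hu0 x (subset_closure hx)).ne')).sub (hud.add contDiffOn_const)
  have hC0 : ContinuousOn (piconeTest q ε u v) (closure Ω) :=
    (((hv.1.add continuousOn_const).rpow_const fun x hx => Or.inl (hv0 x hx).ne').mul
      ((hu.1.add continuousOn_const).rpow_const fun x hx => Or.inl (hu0 x hx).ne')).sub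
        (hu.1.add continuousOn_const)
  have hfr : ∀ x ∈ frontier Ω, piconeTest q ε u v x = 0 := fun x hx => by
    have hx' := frontier_subset_closure hx
    rw [piconeTest_eq_zero_iff hq (hu0 x hx') (hv0 x hx'), hu.2.2.2.2.1 x hx, hv.2.2.2.2.1 x hx]
  have hD : ∀ x ∈ Ω, _ := fun x hx => fderiv_piconeTest_apply_pFlux (q := q) hp
    (hu0 x (subset_closure hx)) (hv0 x (subset_closure hx)) (hu.2.1 x hx) (hv.2.1 x hx)
  obtain ⟨R, hR⟩ := hΩb.isCompact_closure.exists_bound_of_continuousOn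
    ((hv.1.add continuousOn_const).div (hu.1.add continuousOn_const) fun x hx => (hu0 x hx).ne')
  have hIu := hu.2.2.2.2.2.1
  have hIv := hv.2.2.2.2.2.1
  have hint : IntegrableOn (fun x => fderiv ℝ (piconeTest q ε u v) x (pFlux p u x)) Ω := by
    refine Integrable.mono' (((hIu.add hIv).const_mul (q * R ^ (q - 1))).add
      (hIu.const_mul ((q - 1) * R ^ q + 1))) ?_ ?_
    · exact (isBoundedBilinearMap_apply.continuous).comp_aestronglyMeasurable
        (((hC1.continuousOn_fderiv_of_isOpen hΩ le_rfl).aestronglyMeasurable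
          hΩ.measurableSet).prodMk (hu.integrableOn_pFlux hΩ hΩb hp).aestronglyMeasurable)
    · filter_upwards [ae_restrict_mem hΩ.measurableSet] with x hx
      have hx' := subset_closure hx
      have hr : 0 < (v x + ε) / (u x + ε) := div_pos (hv0 x hx') (hu0 x hx')
      have hrR : (v x + ε) / (u x + ε) ≤ R := (le_abs_self _).trans (hR x hx')
      have hy := rpow_sub_mul_rpow_le (norm_nonneg (gradient u x)) (norm_nonneg (gradient v x))
        zero_le_one hp.le (by linarith)
      have hS := abs_fderiv_apply_pFlux_le hp u v x
      rw [Real.rpow_one] at hy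
      have hA : 0 ≤ ‖gradient u x‖ ^ p := by positivity
      have hB : 0 ≤ ‖gradient v x‖ ^ p := by positivity
      have h2 : 0 ≤ 1 / p ∧ 1 / p ≤ 1 := ⟨by positivity, (div_le_one (by linarith)).2 hp.le⟩
      have hS' : |fderiv ℝ v x (pFlux p u x)| ≤ ‖gradient u x‖ ^ p + ‖gradient v x‖ ^ p := by
        nlinarith
      rw [hD x hx]
      set r := (v x + ε) / (u x + ε)
      have h3 : |q * (r ^ (q - 1) * fderiv ℝ v x (pFlux p u x))|
          ≤ q * R ^ (q - 1) * (‖gradient u x‖ ^ p + ‖gradient v x‖ ^ p) := by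
        rw [abs_mul, abs_mul, abs_of_pos (by linarith : 0 < q), abs_of_nonneg (by positivity),
          ← mul_assoc]
        have : 0 ≤ q - 1 := by linarith
        have : 0 < R := hr.trans_le hrR
        gcongr
      have h4 : (q - 1) * (r ^ q * ‖gradient u x‖ ^ p)
          ≤ (q - 1) * (R ^ q * ‖gradient u x‖ ^ p) := by
        have : 0 ≤ q - 1 := by linarith
        gcongr
      have h5 : 0 ≤ (q - 1) * (r ^ q * ‖gradient u x‖ ^ p) := by
        have : 0 ≤ q - 1 := by linarith
        positivity
      simp only [Pi.add_apply, Real.norm_eq_abs]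
      rw [abs_le] at h3 ⊢
      constructor <;> nlinarith
  rw [← integral_fderiv_eq_of_frontier_eq_zero hΩ hΩb (hu.integrableOn_pFlux hΩ hΩb hp)
    (hu.integrableOn_source hΩb hp hq ha) hu.integral_fderiv_eq hC1 hC0 hfr hint]
  have hmeas : NullMeasurableSet {x | u x ≠ v x} (volume.restrict Ω) := by
    have h1 := (hud.continuousOn.aestronglyMeasurable (μ := volume) hΩ.measurableSet).aemeasurable
    have h2 := (hvd.continuousOn.aestronglyMeasurable (μ := volume) hΩ.measurableSet).aemeasurable
    exact (nullMeasurableSet_eq_fun h1 h2).compl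
  have hset : ∀ g : EuclideanSpace ℝ (Fin N) → ℝ, ∀ x ∈ Ω,
      {x | piconeTest q ε u v x ≠ 0}.indicator g x = {x | u x ≠ v x}.indicator g x := by
    intro g x hx
    have := piconeTest_eq_zero_iff hq (hu0 x (subset_closure hx)) (hv0 x (subset_closure hx))
    by_cases h : u x = v x
    · simp [h, this.2 h]
    · simp [h, mt this.1 h]
  rw [setIntegral_congr_fun hΩ.measurableSet (hset _)]
  refine setIntegral_mono_on ?_ ?_ hΩ.measurableSet fun x hx => ?_
  · exact hint.indicator₀ hmeas
  · exact ((hIv.sub hIu).const_mul (q / p)).indicator₀ hmeas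
  · refine indicator_le_indicator ?_
    have hr := div_pos (hv0 x (subset_closure hx)) (hu0 x (subset_closure hx))
    have h := picone_scalar hq hqp hr (norm_nonneg (gradient u x)) (norm_nonneg (gradient v x))
    have hS := (le_abs_self _).trans (abs_fderiv_apply_pFlux_le hp u v x)
    rw [hD x hx]
    have : q * (((v x + ε) / (u x + ε)) ^ (q - 1) * fderiv ℝ v x (pFlux p u x)) ≤
        q * (((v x + ε) / (u x + ε)) ^ (q - 1) *
          (‖gradient u x‖ ^ (p - 1) * ‖gradient v x‖)) := by gcongr
    linarith

theorem tendsto_integral_source_mul_piconeTest {N : ℕ} {Ω : Set (EuclideanSpace ℝ (Fin N))}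
    (hΩ : IsOpen Ω) (hΩb : Bornology.IsBounded Ω) {p q lam : ℝ} (hq : 1 < q) (hqp : q < p)
    {a u v : EuclideanSpace ℝ (Fin N) → ℝ} (ha : ContinuousOn a (closure Ω))
    (hu : DirichletSol Ω p q lam a u) (hv : DirichletSol Ω p q lam a v)
    (hupos : ∀ x ∈ Ω, 0 < u x) (hvpos : ∀ x ∈ Ω, 0 < v x) :
    Tendsto (fun n : ℕ => ∫ x in Ω, source p q lam a u x * piconeTest q (1 / (n + 1 : ℝ)) u v x)
      atTop (𝓝 (∫ x in Ω, (lam * u x ^ (p - q) + a x) * (v x ^ q - u x ^ q))) := by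
  obtain ⟨Mu, hMu⟩ := hΩb.isCompact_closure.exists_bound_of_continuousOn hu.1
  obtain ⟨Mv, hMv⟩ := hΩb.isCompact_closure.exists_bound_of_continuousOn hv.1
  obtain ⟨C, hC⟩ := hΩb.isCompact_closure.exists_bound_of_continuousOn
    ((continuousOn_const.mul (hu.1.rpow_const fun _ _ => Or.inr (by linarith))).add ha :
      ContinuousOn (fun x => lam * u x ^ (p - q) + a x) (closure Ω))
  have hsrc : ∀ x ∈ Ω, source p q lam a u x = u x ^ (q - 1) * (lam * u x ^ (p - q) + a x) := by
    intro x hx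
    have : u x ^ (p - 1) = u x ^ (q - 1) * u x ^ (p - q) := by
      rw [← Real.rpow_add (hupos x hx)]; congr 1; ring
    rw [source, this]; ring
  have hε : ∀ n : ℕ, 0 < 1 / (n + 1 : ℝ) := fun n => by positivity
  have hε1 : ∀ n : ℕ, 1 / (n + 1 : ℝ) ≤ 1 := fun n => by
    rw [div_le_one (by positivity)]; linarith [n.cast_nonneg (α := ℝ)]
  refine tendsto_integral_of_dominated_convergence
    (fun _ => C * (max Mu Mv + 1) ^ q) (fun n => ?_) ?_ (fun n => ?_) ?_
  · refine (hu.integrableOn_source hΩb (hq.trans hqp) hq ha).aestronglyMeasurable.mul ?_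
    have hu' := (hu.contDiffOn hΩ).continuousOn.add (continuousOn_const (c := 1 / (n + 1 : ℝ)))
    have hv' := (hv.contDiffOn hΩ).continuousOn.add (continuousOn_const (c := 1 / (n + 1 : ℝ)))
    have : ContinuousOn (piconeTest q (1 / (n + 1 : ℝ)) u v) Ω :=
      ((hv'.rpow_const fun x hx => Or.inl (add_pos (hvpos x hx) (hε n)).ne').mul
        (hu'.rpow_const fun x hx => Or.inl (add_pos (hupos x hx) (hε n)).ne')).sub hu'
    exact this.aestronglyMeasurable hΩ.measurableSet
  · exact integrableOn_const hΩb.measure_lt_top.ne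
  · filter_upwards [ae_restrict_mem hΩ.measurableSet] with x hx
    have hx' := subset_closure hx
    have hux := hupos x hx
    have hvx := hvpos x hx
    have hεn := hε n
    have hεn1 := hε1 n
    set ε := 1 / (n + 1 : ℝ)
    have hU : 0 < u x + ε := by linarith
    have hV : 0 < v x + ε := by linarith
    rw [hsrc x hx, piconeTest_eq hU]
    have h1 : u x ^ (q - 1) * (u x + ε) ^ (1 - q) ≤ 1 := by
      rw [show 1 - q = -(q - 1) by ring, Real.rpow_neg hU.le, ← div_eq_mul_inv,
        div_le_one (by positivity)]
      exact Real.rpow_le_rpow hux.le (by linarith) (by linarith)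
    have h2 : (u x + ε) ^ q ≤ (max Mu Mv + 1) ^ q := by
      refine Real.rpow_le_rpow hU.le ?_ (by linarith)
      linarith [(le_abs_self _).trans (hMu x hx'), le_max_left Mu Mv]
    have h3 : (v x + ε) ^ q ≤ (max Mu Mv + 1) ^ q := by
      refine Real.rpow_le_rpow hV.le ?_ (by linarith)
      linarith [(le_abs_self _).trans (hMv x hx'), le_max_right Mu Mv]
    have h4 : |(v x + ε) ^ q - (u x + ε) ^ q| ≤ (max Mu Mv + 1) ^ q := by
      rw [abs_le]
      constructor <;> linarith [Real.rpow_pos_of_pos hU q, Real.rpow_pos_of_pos hV q]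
    have h5 : |lam * u x ^ (p - q) + a x| ≤ C := hC x hx'
    calc _ = (u x ^ (q - 1) * (u x + ε) ^ (1 - q)) * (|lam * u x ^ (p - q) + a x| *
          |(v x + ε) ^ q - (u x + ε) ^ q|) := by
          rw [Real.norm_eq_abs, abs_mul, abs_mul, abs_mul, abs_of_pos (by positivity),
            abs_of_pos (Real.rpow_pos_of_pos hU _)]
          ring
      _ ≤ 1 * (|lam * u x ^ (p - q) + a x| * |(v x + ε) ^ q - (u x + ε) ^ q|) := by gcongr
      _ ≤ _ := by
        rw [one_mul]
        exact mul_le_mul h5 h4 (abs_nonneg _) ((abs_nonneg _).trans h5)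
  · filter_upwards [ae_restrict_mem hΩ.measurableSet] with x hx
    have hux := hupos x hx
    have hvx := hvpos x hx
    have hcont : ContinuousAt (fun ε : ℝ => source p q lam a u x * piconeTest q ε u v x) 0 := by
      unfold piconeTest
      have h1 : ContinuousAt (fun ε : ℝ => u x + ε) 0 := by fun_prop
      have h2 : ContinuousAt (fun ε : ℝ => v x + ε) 0 := by fun_prop
      exact continuousAt_const.mul (((h2.rpow_const (Or.inl (by simpa using hvx.ne'))).mul
        (h1.rpow_const (Or.inl (by simpa using hux.ne')))).sub h1)
    have heq : (lam * u x ^ (p - q) + a x) * (v x ^ q - u x ^ q)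
        = source p q lam a u x * piconeTest q 0 u v x := by
      rw [hsrc x hx, piconeTest_eq (by rwa [add_zero])]
      have : u x ^ (q - 1) * u x ^ (1 - q) = 1 := by
        rw [← Real.rpow_add hux]; simp
      simp only [add_zero]
      linear_combination (-(lam * u x ^ (p - q) + a x) * (v x ^ q - u x ^ q)) * this
    rw [heq]
    exact hcont.tendsto.comp (tendsto_one_div_add_atTop_nhds_zero_nat (𝕜 := ℝ))

theorem rpow_sub_mul_rpow_sub_nonneg {s t b c : ℝ} (hs : 0 ≤ s) (ht : 0 ≤ t) (hb : 0 < b)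
    (hc : 0 < c) : 0 ≤ (s ^ b - t ^ b) * (s ^ c - t ^ c) := by
  rcases le_total s t with h | h
  · exact mul_nonneg_of_nonpos_of_nonpos (sub_nonpos.2 (Real.rpow_le_rpow hs h hb.le))
      (sub_nonpos.2 (Real.rpow_le_rpow hs h hc.le))
  · exact mul_nonneg (sub_nonneg.2 (Real.rpow_le_rpow ht h hb.le))
      (sub_nonneg.2 (Real.rpow_le_rpow ht h hc.le))

/-- For `λ < 0`, `(P_λ)` has at most one positive Dirichlet weak solution. -/
theorem at_most_one_positive_solution
    {N : ℕ} (hN : 1 ≤ N) (Ω : Set (EuclideanSpace ℝ (Fin N)))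
    (hΩne : Ω.Nonempty) (hΩo : IsOpen Ω) (hΩb : Bornology.IsBounded Ω)
    (p q : ℝ) (h1q : 1 < q) (hqp : q < p)
    (a : EuclideanSpace ℝ (Fin N) → ℝ) (ha : ContinuousOn a (closure Ω))
    (haplus : ∃ x ∈ Ω, 0 < a x) (haminus : ∃ x ∈ Ω, a x < 0)
    (lam : ℝ) (hlam : lam < 0)
    (u v : EuclideanSpace ℝ (Fin N) → ℝ)
    (hu : DirichletSol Ω p q lam a u) (hv : DirichletSol Ω p q lam a v)
    (hupos : ∀ x ∈ Ω, 0 < u x) (hvpos : ∀ x ∈ Ω, 0 < v x) :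
    ∀ x ∈ Ω, u x = v x := by
  have hconv := tendsto_integral_source_mul_piconeTest hΩo hΩb h1q hqp ha hu hv hupos hvpos
  have hconv' := tendsto_integral_source_mul_piconeTest hΩo hΩb h1q hqp ha hv hu hvpos hupos
  have hsum : (∫ x in Ω, (lam * u x ^ (p - q) + a x) * (v x ^ q - u x ^ q)) +
      ∫ x in Ω, (lam * v x ^ (p - q) + a x) * (u x ^ q - v x ^ q) ≤ 0 := by
    refine le_of_tendsto' (hconv.add hconv') fun n => ?_
    have hε : 0 < 1 / (n + 1 : ℝ) := by positivity
    have h1 := integral_source_mul_piconeTest_le hΩo hΩb h1q hqp ha hu hv hε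
    have h2 := integral_source_mul_piconeTest_le hΩo hΩb h1q hqp ha hv hu hε
    refine (add_le_add h1 h2).trans (le_of_eq ?_)
    rw [← eq_neg_iff_add_eq_zero, ← integral_neg]
    congr 1 with x
    by_cases h : u x = v x
    · simp [h]
    · simp only [indicator, mem_ofPred_eq, ne_eq, h, Ne.symm h, not_false_eq_true, if_true]
      ring
  have hcu : ∀ b : ℝ, 0 < b → ContinuousOn (fun x => u x ^ b) (closure Ω) := fun b hb =>
    hu.1.rpow_const fun _ _ => Or.inr hb.le
  have hcv : ∀ b : ℝ, 0 < b → ContinuousOn (fun x => v x ^ b) (closure Ω) := fun b hb =>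
    hv.1.rpow_const fun _ _ => Or.inr hb.le
  have hq0 : 0 < q := by linarith
  have hpq0 : 0 < p - q := by linarith
  have hint : ∀ g : EuclideanSpace ℝ (Fin N) → ℝ, ContinuousOn g (closure Ω) →
      IntegrableOn g Ω := fun g hg =>
    (hg.integrableOn_compact hΩb.isCompact_closure).mono_set subset_closure
  have hgc : ContinuousOn
      (fun x => (u x ^ q - v x ^ q) * (u x ^ (p - q) - v x ^ (p - q))) (closure Ω) :=
    ((hcu q hq0).sub (hcv q hq0)).mul ((hcu _ hpq0).sub (hcv _ hpq0))
  have hg0 : ∀ x ∈ Ω, 0 ≤ (u x ^ q - v x ^ q) * (u x ^ (p - q) - v x ^ (p - q)) := fun x hx =>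
    rpow_sub_mul_rpow_sub_nonneg (hupos x hx).le (hvpos x hx).le hq0 hpq0
  have hi1 : IntegrableOn (fun x => (lam * u x ^ (p - q) + a x) * (v x ^ q - u x ^ q)) Ω :=
    hint _ (((continuousOn_const.mul (hcu _ hpq0)).add ha).mul ((hcv q hq0).sub (hcu q hq0)))
  have hi2 : IntegrableOn (fun x => (lam * v x ^ (p - q) + a x) * (u x ^ q - v x ^ q)) Ω :=
    hint _ (((continuousOn_const.mul (hcv _ hpq0)).add ha).mul ((hcu q hq0).sub (hcv q hq0)))
  rw [← integral_add hi1 hi2] at hsum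
  have hrew : ∀ x, (lam * u x ^ (p - q) + a x) * (v x ^ q - u x ^ q) +
      (lam * v x ^ (p - q) + a x) * (u x ^ q - v x ^ q) =
      -lam * ((u x ^ q - v x ^ q) * (u x ^ (p - q) - v x ^ (p - q))) := fun x => by ring
  simp_rw [hrew] at hsum
  rw [integral_const_mul] at hsum
  have hnn := setIntegral_nonneg (μ := volume) hΩo.measurableSet hg0
  have hzero : ∫ x in Ω, (u x ^ q - v x ^ q) * (u x ^ (p - q) - v x ^ (p - q)) = 0 := by
    nlinarith
  rw [setIntegral_eq_zero_iff_of_nonneg_ae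
    ((ae_restrict_iff' hΩo.measurableSet).2 (ae_of_all _ hg0)) (hint _ hgc)] at hzero
  have heq := Measure.eqOn_open_of_ae_eq hzero hΩo (hgc.mono subset_closure) continuousOn_const
  intro x hx
  rcases mul_eq_zero.1 (heq hx) with h | h
  · exact (Real.rpow_left_inj (hupos x hx).le (hvpos x hx).le hq0.ne').1 (sub_eq_zero.1 h)
  · exact (Real.rpow_left_inj (hupos x hx).le (hvpos x hx).le hpq0.ne').1 (sub_eq_zero.1 h)
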